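/- arXiv:1103.1529 — 3 statements merged into one kernel-verified Lean document; each statement's English description precedes it below -/
import Mathlib

section
/- Let k ≥ 1 and let Δ ⊆ ℝ^k be the standard simplex, i.e. the convex hull of the standard basis vectors e_1, …, e_k. Let A_1, …, A_k be closed subsets of Δ such that for every nonempty subset S ⊆ {1, …, k} the face conv{e_i : i ∈ S} is contained in ⋃_{i ∈ S} A_i. Then the intersection A_1 ∩ … ∩ A_k is nonempty. -/
/-- A finite set `E` is dominant for the family of rankings `r` if no point lies strictly above
the minimum of `E` in every ranking. -/
def Dominant {I V L : Type*} [LinearOrder L] (r : I → V → L) (E : Finset V) : Prop :=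
  ∀ y, ∃ i, ∀ x ∈ E, r i y ≤ r i x

/-- A dominant set with one element fewer than there are rankings has exactly two dominant
one-point extensions, provided that it can be extended past every index. -/
theorem exists_two_dominant_insert {I V L : Type*} [Fintype I] [DecidableEq I] [Fintype V]
    [DecidableEq V] [LinearOrder L] (r : I → V → L) (hr : ∀ i, Function.Injective (r i))
    (E : Finset V) (hE : Dominant r E) (hne : E.Nonempty) (hcard : E.card + 1 = Fintype.card I)
    (hY : ∀ l, ∃ y, ∀ m, m ≠ l → ∃ x ∈ E, r m x < r m y) :
    ∃ a b, a ≠ b ∧ ∀ x, (x ∉ E ∧ Dominant r (insert x E)) ↔ (x = a ∨ x = b) := by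
  classical
  have hmin : ∀ m, ∃ x ∈ E, ∀ x' ∈ E, r m x ≤ r m x' := fun m => E.exists_min_image (r m) hne
  choose μ hμE hμ using hmin
  have hμuniq : ∀ m, ∀ x ∈ E, (∀ x' ∈ E, r m x ≤ r m x') → μ m = x := fun m x hx h =>
    hr m (le_antisymm (hμ m x hx) (h _ (hμE m)))
  have hsurj : ∀ x ∈ E, ∃ m, μ m = x := fun x hx => by
    obtain ⟨m, hm⟩ := hE x
    exact ⟨m, hμuniq m x hx hm⟩
  have hinj : ∀ l, (∀ x ∈ E, ∃ m, m ≠ l ∧ μ m = x) →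
      ∀ m m', m ≠ l → m' ≠ l → μ m = μ m' → m = m' := by
    intro l hl m m' hm hm' h
    have himg : (Finset.univ.erase l).image μ = E := by
      ext x
      simp only [Finset.mem_image, Finset.mem_erase, Finset.mem_univ, and_true]
      constructor
      · rintro ⟨m, -, rfl⟩
        exact hμE m
      · exact hl x
    have hc : ((Finset.univ.erase l).image μ).card = (Finset.univ.erase l).card := by
      rw [himg, Finset.card_erase_of_mem (Finset.mem_univ l), Finset.card_univ]
      omega
    exact Finset.card_image_iff.1 hc (by simpa using hm) (by simpa using hm') h
  obtain ⟨i, -, j, -, hij, hμij⟩ : ∃ i ∈ (Finset.univ : Finset I), ∃ j ∈ (Finset.univ : Finset I),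
      i ≠ j ∧ μ i = μ j :=
    Finset.exists_ne_map_eq_of_card_lt_of_maps_to (t := E)
      (by rw [Finset.card_univ]; omega) (fun m _ => hμE m)
  have hsurj' : ∀ l, l = i ∨ l = j → ∀ x ∈ E, ∃ m, m ≠ l ∧ μ m = x := by
    intro l hl x hx
    obtain ⟨m, hm⟩ := hsurj x hx
    by_cases hml : m = l
    · rcases hl with rfl | rfl
      · exact ⟨j, hij.symm, by rw [← hμij, ← hml, hm]⟩
      · exact ⟨i, hij, by rw [hμij, ← hml, hm]⟩
    · exact ⟨m, hml, hm⟩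
  have hor : ∀ l, (∀ x ∈ E, ∃ m, m ≠ l ∧ μ m = x) → l = i ∨ l = j := by
    intro l hl
    by_contra! h
    exact hij (hinj l hl i j h.1.symm h.2.symm hμij)
  have hmax : ∀ l, ∃ x, (∀ m, m ≠ l → r m (μ m) < r m x) ∧
      ∀ y, (∀ m, m ≠ l → r m (μ m) < r m y) → r l y ≤ r l x := by
    intro l
    obtain ⟨y, hy⟩ := hY l
    obtain ⟨x, hx, hx'⟩ := (Finset.univ.filter
      (fun y => ∀ m, m ≠ l → r m (μ m) < r m y)).exists_max_image (r l) ⟨y, by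
        simp only [Finset.mem_filter, Finset.mem_univ, true_and]
        intro m hm
        obtain ⟨x, hx, hxy⟩ := hy m hm
        exact (hμ m x hx).trans_lt hxy⟩
    simp only [Finset.mem_filter, Finset.mem_univ, true_and] at hx hx'
    exact ⟨x, hx, hx'⟩
  choose t ht htmax using hmax
  have hext : ∀ l, l = i ∨ l = j → t l ∉ E ∧ Dominant r (insert (t l) E) := by
    intro l hl
    refine ⟨fun h => ?_, fun y => ?_⟩
    · obtain ⟨m, hm, hm'⟩ := hsurj' l hl _ h
      exact absurd (ht l m hm) (by rw [hm']; exact lt_irrefl _)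
    · by_cases hy : ∀ m, m ≠ l → r m (μ m) < r m y
      · obtain ⟨m, hm⟩ := hE y
        have hml : m = l := by
          by_contra h
          exact absurd (hm _ (hμE m)) (not_le.2 (hy m h))
        subst hml
        refine ⟨m, fun x hx => ?_⟩
        rcases Finset.mem_insert.1 hx with rfl | hx
        · exact htmax m y hy
        · exact hm x hx
      · push Not at hy
        obtain ⟨m, hm, hmy⟩ := hy
        refine ⟨m, fun x hx => ?_⟩
        rcases Finset.mem_insert.1 hx with rfl | hx
        · exact hmy.trans (ht l m hm).le
        · exact hmy.trans (hμ m x hx)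
  refine ⟨t i, t j, fun h => ?_, fun x => ⟨?_, ?_⟩⟩
  · obtain ⟨m, hm⟩ := hE (t i)
    by_cases hmi : m = i
    · have := ht j m (hmi ▸ hij)
      rw [← h] at this
      exact absurd (hm _ (hμE m)) (not_le.2 this)
    · exact absurd (hm _ (hμE m)) (not_le.2 (ht i m hmi))
  · rintro ⟨hxE, hx⟩
    obtain ⟨l, hl⟩ := hx x
    have hdom : ∀ y ∈ E, ∃ m, m ≠ l ∧ μ m = y ∧ r m y ≤ r m x := by
      intro y hy
      obtain ⟨m, hm⟩ := hx y
      refine ⟨m, ?_, hμuniq m y hy fun z hz => hm z (Finset.mem_insert_of_mem hz),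
        hm x (Finset.mem_insert_self _ _)⟩
      rintro rfl
      have : x = y := hr m (le_antisymm (hl y (Finset.mem_insert_of_mem hy))
        (hm x (Finset.mem_insert_self _ _)))
      exact hxE (this ▸ hy)
    have hs : ∀ y ∈ E, ∃ m, m ≠ l ∧ μ m = y := fun y hy =>
      let ⟨m, h1, h2, _⟩ := hdom y hy
      ⟨m, h1, h2⟩
    have hxY : ∀ m, m ≠ l → r m (μ m) < r m x := by
      intro m hm
      obtain ⟨m', h1, h2, h3⟩ := hdom _ (hμE m)
      obtain rfl := hinj l hs m' m h1 hm h2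
      refine lt_of_le_of_ne h3 fun h => hxE ?_
      rw [← hr m' h]
      exact hμE m'
    have hxt : x = t l := by
      refine hr l (le_antisymm (htmax l x hxY) ?_)
      obtain ⟨m, hm⟩ := hx (t l)
      by_cases hml : m = l
      · subst hml
        exact hm x (Finset.mem_insert_self _ _)
      · exact absurd (hm _ (Finset.mem_insert_of_mem (hμE m))) (not_le.2 (ht l m hml))
    rcases hor l hs with rfl | rfl
    · exact Or.inl hxt
    · exact Or.inr hxt
  · rintro (rfl | rfl)
    · exact hext i (Or.inl rfl)
    · exact hext j (Or.inr rfl)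

/-- If a set of `card I` points misses a colour, its one-point deletions coloured exactly by
`I \ {i₀}` come in a pair, or there are none. -/
theorem even_card_erase_image_eq {I V : Type*} [Fintype I] [DecidableEq I] [DecidableEq V]
    (c : V → I) (i₀ : I) (R : Finset V) (hR : R.card = Fintype.card I)
    (hc : R.image c ≠ Finset.univ) (F : Finset (Finset V))
    (hF : ∀ E, E ∈ F ↔ E.image c = Finset.univ.erase i₀ ∧ ∃ x, x ∉ E ∧ insert x E = R) :
    Even F.card := by
  rcases F.eq_empty_or_nonempty with rfl | ⟨E, hE⟩
  · simp
  obtain ⟨himg, x, hxE, rfl⟩ := (hF E).1 hE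
  have hcx : c x ≠ i₀ := by
    rintro h
    apply hc
    rw [Finset.image_insert, himg, h, Finset.insert_erase (Finset.mem_univ _)]
  have hcardE : E.card + 1 = Fintype.card I := by
    rw [← hR, Finset.card_insert_of_notMem hxE]
  have hinj : ∀ E' : Finset V, E'.card + 1 = Fintype.card I →
      E'.image c = Finset.univ.erase i₀ → Set.InjOn c E' := by
    intro E' h1 h2
    apply Finset.card_image_iff.1
    rw [h2, Finset.card_erase_of_mem (Finset.mem_univ _), Finset.card_univ]
    omega
  obtain ⟨x', hx', hcx'⟩ : ∃ x' ∈ E, c x' = c x := by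
    rw [← Finset.mem_image, himg]
    simpa using hcx
  have hxx' : x ≠ x' := fun h => hxE (h ▸ hx')
  have hFeq : F = {E, (insert x E).erase x'} := by
    ext G
    rw [hF, Finset.mem_insert, Finset.mem_singleton]
    constructor
    · rintro ⟨hG, y, hyG, hyR⟩
      have hGR : G = (insert x E).erase y := by rw [← hyR, Finset.erase_insert hyG]
      have hGc : G.card + 1 = Fintype.card I := by
        rw [← hR, ← hyR, Finset.card_insert_of_notMem hyG]
      by_cases hyx : y = x
      · left
        rw [hGR, hyx, Finset.erase_insert hxE]
      by_cases hyx' : y = x'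
      · right
        rw [hGR, hyx']
      exfalso
      refine hxx' (hinj G hGc hG ?_ ?_ hcx'.symm)
      · simp [hGR, Ne.symm hyx]
      · simp [hGR, Ne.symm hyx', hx']
    · rintro (rfl | rfl)
      · exact ⟨himg, x, hxE, rfl⟩
      · refine ⟨?_, x', Finset.notMem_erase _ _,
          Finset.insert_erase (Finset.mem_insert_of_mem hx')⟩
        rw [← himg]
        ext m
        simp only [Finset.mem_image, Finset.mem_erase, Finset.mem_insert]
        constructor
        · rintro ⟨y, ⟨-, rfl | hy⟩, rfl⟩
          · exact ⟨x', hx', hcx'⟩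
          · exact ⟨y, hy, rfl⟩
        · rintro ⟨y, hy, rfl⟩
          by_cases h : y = x'
          · exact ⟨x, ⟨hxx', Or.inl rfl⟩, by rw [h, hcx']⟩
          · exact ⟨y, ⟨h, Or.inr hy⟩, rfl⟩
  rw [hFeq, Finset.card_pair]
  · exact even_two
  · intro h
    have : x' ∈ (insert x E).erase x' := h ▸ hx'
    simp at this

/-- A Sperner-type lemma for rankings: a fully coloured dominant set exists. -/
theorem exists_dominant_image_eq_univ {I V L : Type*} [Fintype I] [DecidableEq I] [Nonempty I]
    [Fintype V] [DecidableEq V] [LinearOrder L] (r : I → V → L)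
    (hr : ∀ i, Function.Injective (r i)) (e : I → V) (c : V → I) (hce : ∀ i, c (e i) = i)
    (hlow : ∀ i v, v ≠ e i → r i (e i) < r i v)
    (hhigh : ∀ i l v, l ≠ i → v ∉ Set.range e → r i v < r i (e l))
    (hX : ∃ v, v ∉ Set.range e) :
    ∃ R : Finset V, Dominant r R ∧ R.image c = Finset.univ := by
  classical
  by_contra! hcon
  obtain ⟨i₀⟩ := ‹Nonempty I›
  have hej : Function.Injective e := Function.LeftInverse.injective hce
  set rooms : Finset (Finset V) :=
    Finset.univ.filter fun R => Dominant r R ∧ R.card = Fintype.card I with hrooms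
  set doors : Finset (Finset V) :=
    Finset.univ.filter fun E => E.image c = Finset.univ.erase i₀ ∧ E.card + 1 = Fintype.card I
    with hdoors
  let adj : Finset V → Finset V → Prop := fun E R => ∃ x, x ∉ E ∧ insert x E = R
  have hcount := Finset.sum_card_bipartiteAbove_eq_sum_card_bipartiteBelow
    (s := doors) (t := rooms) adj
  have hright : Even (∑ R ∈ rooms, (Finset.bipartiteBelow adj doors R).card) := by
    refine Finset.even_sum _ fun R hR => ?_
    simp only [hrooms, Finset.mem_filter, Finset.mem_univ, true_and] at hR
    refine even_card_erase_image_eq c i₀ R hR.2 (hcon R hR.1) _ fun E => ?_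
    simp only [Finset.mem_bipartiteBelow, hdoors, Finset.mem_filter, Finset.mem_univ, true_and]
    constructor
    · rintro ⟨⟨h1, -⟩, h2⟩
      exact ⟨h1, h2⟩
    · rintro ⟨h1, x, hx, hxR⟩
      exact ⟨⟨h1, by rw [← hR.2, ← hxR, Finset.card_insert_of_notMem hx]⟩, x, hx, hxR⟩
  have habove : ∀ E ∈ doors, ∀ R, R ∈ Finset.bipartiteAbove adj rooms E ↔
      ∃ x, (x ∉ E ∧ Dominant r (insert x E)) ∧ insert x E = R := by
    intro E hE R
    simp only [hdoors, Finset.mem_filter, Finset.mem_univ, true_and] at hE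
    simp only [Finset.mem_bipartiteAbove, hrooms, Finset.mem_filter, Finset.mem_univ, true_and]
    constructor
    · rintro ⟨⟨h1, -⟩, x, hx, rfl⟩
      exact ⟨x, ⟨hx, h1⟩, rfl⟩
    · rintro ⟨x, ⟨hx, h1⟩, rfl⟩
      exact ⟨⟨h1, by rw [Finset.card_insert_of_notMem hx, hE.2]⟩, x, hx, rfl⟩
  set E₀ : Finset V := (Finset.univ.erase i₀).image e with hE₀
  have hE₀mem : ∀ v, v ∈ E₀ ↔ ∃ p, p ≠ i₀ ∧ e p = v := by simp [hE₀]
  have hE₀d : E₀ ∈ doors := by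
    simp only [hdoors, Finset.mem_filter, Finset.mem_univ, true_and]
    constructor
    · rw [hE₀, Finset.image_image]
      have : c ∘ e = id := funext hce
      rw [this, Finset.image_id]
    · rw [hE₀, Finset.card_image_of_injective _ hej,
        Finset.card_erase_of_mem (Finset.mem_univ _), Finset.card_univ]
      have := Fintype.card_pos_iff.2 ⟨i₀⟩
      omega
  have houter : (Finset.bipartiteAbove adj rooms E₀).card = 1 := by
    obtain ⟨v, hv⟩ := hX
    obtain ⟨w, hw, hwmax⟩ := (Finset.univ.filter fun v => v ∉ Set.range e).exists_max_image
      (r i₀) ⟨v, by simpa using hv⟩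
    replace hw : w ∉ Set.range e := (Finset.mem_filter.1 hw).2
    replace hwmax : ∀ y, y ∉ Set.range e → r i₀ y ≤ r i₀ w := fun y hy =>
      hwmax y (Finset.mem_filter.2 ⟨Finset.mem_univ _, hy⟩)
    rw [Finset.card_eq_one]
    refine ⟨insert w E₀, ?_⟩
    ext R
    rw [habove E₀ hE₀d, Finset.mem_singleton]
    constructor
    · rintro ⟨x, ⟨hx, hdom⟩, rfl⟩
      have key : ∀ y, y ∉ Set.range e → r i₀ y ≤ r i₀ x := by
        intro y hy
        obtain ⟨m, hm⟩ := hdom y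
        by_cases hmi : m = i₀
        · exact hmi ▸ hm x (Finset.mem_insert_self _ _)
        · exact absurd (hm (e m) (Finset.mem_insert_of_mem ((hE₀mem _).2 ⟨m, hmi, rfl⟩)))
            (not_le.2 (hlow m y fun h => hy ⟨m, h.symm⟩))
      have hxr : x ∉ Set.range e := by
        rintro ⟨p, rfl⟩
        by_cases hp : p = i₀
        · subst hp
          exact absurd (key v hv) (not_le.2 (hlow p v fun h => hv ⟨p, h.symm⟩))
        · exact hx ((hE₀mem _).2 ⟨p, hp, rfl⟩)
      rw [hr i₀ (le_antisymm (hwmax x hxr) (key w hw))]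
    · rintro rfl
      refine ⟨w, ⟨fun h => ?_, fun y => ?_⟩, rfl⟩
      · obtain ⟨p, -, hp⟩ := (hE₀mem _).1 h
        exact hw ⟨p, hp⟩
      · by_cases hy : y ∈ Set.range e
        · obtain ⟨p, rfl⟩ := hy
          refine ⟨p, fun x _ => ?_⟩
          by_cases h : x = e p
          · rw [h]
          · exact (hlow p x h).le
        · refine ⟨i₀, fun x hx => ?_⟩
          rcases Finset.mem_insert.1 hx with rfl | hx
          · exact hwmax y hy
          · obtain ⟨p, hp, rfl⟩ := (hE₀mem _).1 hx
            exact (hhigh i₀ p y hp hy).le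
  have hinner : ∀ E ∈ doors.erase E₀, Even (Finset.bipartiteAbove adj rooms E).card := by
    intro E hE
    obtain ⟨hne, hEd⟩ := Finset.mem_erase.1 hE
    have hEd' := hEd
    simp only [hdoors, Finset.mem_filter, Finset.mem_univ, true_and] at hEd'
    obtain ⟨himg, hcard⟩ := hEd'
    obtain ⟨v, hvE, hv⟩ : ∃ v ∈ E, v ∉ Set.range e := by
      by_contra! h
      apply hne
      refine Finset.eq_of_subset_of_card_le (fun x hx => ?_) ?_
      · obtain ⟨p, rfl⟩ := h x hx
        refine (hE₀mem _).2 ⟨p, ?_, rfl⟩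
        have : c (e p) ∈ E.image c := Finset.mem_image_of_mem c hx
        rw [himg, hce] at this
        exact (Finset.mem_erase.1 this).1
      · have := (Finset.mem_filter.1 hE₀d).2.2
        omega
    by_cases hdom : Dominant r E
    · obtain ⟨a, b, hab, hiff⟩ := exists_two_dominant_insert r hr E hdom ⟨v, hvE⟩ hcard
        fun l => ⟨e l, fun m hm => ⟨v, hvE, hhigh m l v hm.symm hv⟩⟩
      have : Finset.bipartiteAbove adj rooms E = {insert a E, insert b E} := by
        ext R
        rw [habove E hEd, Finset.mem_insert, Finset.mem_singleton]
        constructor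
        · rintro ⟨x, hx, rfl⟩
          rcases (hiff x).1 hx with rfl | rfl
          · exact Or.inl rfl
          · exact Or.inr rfl
        · rintro (rfl | rfl)
          · exact ⟨a, (hiff a).2 (Or.inl rfl), rfl⟩
          · exact ⟨b, (hiff b).2 (Or.inr rfl), rfl⟩
      rw [this, Finset.card_pair]
      · exact even_two
      · intro h
        have ha : a ∈ insert b E := h ▸ Finset.mem_insert_self a E
        rcases Finset.mem_insert.1 ha with h | h
        · exact hab h
        · exact ((hiff a).2 (Or.inl rfl)).1 h
    · have : Finset.bipartiteAbove adj rooms E = ∅ := by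
        ext R
        rw [habove E hEd]
        simp only [Finset.notMem_empty, iff_false]
        rintro ⟨x, ⟨-, hx⟩, -⟩
        apply hdom
        intro y
        obtain ⟨m, hm⟩ := hx y
        exact ⟨m, fun z hz => hm z (Finset.mem_insert_of_mem hz)⟩
      rw [this]
      simp
  rw [← hcount, ← Finset.add_sum_erase _ _ hE₀d, houter] at hright
  have := Finset.even_sum _ hinner
  rw [Nat.even_add] at hright
  exact absurd (hright.2 this) (by decide)

/-- Given finitely many points, real coordinates and a colouring by indices, some nonempty set
`D` of points is not exceeded by any point in all the coordinates that occur as colours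
on `D`. -/
theorem exists_dominant_of_coloring {I X : Type*} [Fintype I] [DecidableEq I] [Nonempty I]
    [Fintype X] [Nonempty X] (f : X → I → ℝ) (hf : ∀ x i, f x i ∈ Set.Icc (0 : ℝ) 1)
    (c : X → I) :
    ∃ D : Finset X, D.Nonempty ∧ ∀ y, ∃ i ∈ D.image c, ∀ x ∈ D, f y i ≤ f x i := by
  classical
  let ν : X ≃ Fin (Fintype.card X) := Fintype.equivFin X
  let κ : I ≃ Fin (Fintype.card I) := Fintype.equivFin I
  let r : I → X ⊕ I → ℝ ×ₗ ℕ := fun i =>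
    Sum.elim (fun x => toLex (f x i, (ν x : ℕ)))
      (fun l => if l = i then toLex (-1, 0) else toLex (2, (κ l : ℕ)))
  have hlow : ∀ i v, v ≠ Sum.inr i → r i (Sum.inr i) < r i v := by
    rintro i (x | l) hv
    · simp only [r, Sum.elim_inl, Sum.elim_inr, if_true, Prod.Lex.toLex_lt_toLex]
      left
      linarith [(hf x i).1]
    · have : l ≠ i := fun h => hv (by rw [h])
      simp only [r, Sum.elim_inr, if_true, if_neg this, Prod.Lex.toLex_lt_toLex]
      left
      norm_num
  have hhigh' : ∀ i l x, l ≠ i → r i (Sum.inl x) < r i (Sum.inr l) := by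
    intro i l x hl
    simp only [r, Sum.elim_inl, Sum.elim_inr, if_neg hl, Prod.Lex.toLex_lt_toLex]
    left
    linarith [(hf x i).2]
  have hr : ∀ i, Function.Injective (r i) := by
    rintro i (x | l) (y | m) h
    · simp only [r, Sum.elim_inl, toLex_inj, Prod.mk.injEq] at h
      rw [ν.injective (Fin.ext h.2)]
    · by_cases hm : m = i
      · subst hm
        exact absurd h (hlow m (Sum.inl x) (by simp)).ne'
      · exact absurd h (hhigh' i m x hm).ne
    · by_cases hl : l = i
      · subst hl
        exact absurd h (hlow l (Sum.inl y) (by simp)).ne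
      · exact absurd h (hhigh' i l y hl).ne'
    · by_contra hne
      by_cases hl : l = i
      · subst hl
        exact absurd h (hlow l _ (Ne.symm hne)).ne
      · by_cases hm : m = i
        · subst hm
          exact absurd h (hlow m _ hne).ne'
        · simp only [r, Sum.elim_inr, if_neg hl, if_neg hm, toLex_inj, Prod.mk.injEq] at h
          exact hne (by rw [κ.injective (Fin.ext h.2)])
  obtain ⟨R, hR, himg⟩ := exists_dominant_image_eq_univ r hr Sum.inr (Sum.elim c id)
    (fun i => rfl) hlow
    (by
      rintro i l (x | m) hl hv
      · exact hhigh' i l x hl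
      · exact absurd ⟨m, rfl⟩ hv)
    ⟨Sum.inl (Classical.arbitrary X), by simp⟩
  have hslack : ∀ i, (∀ x, Sum.inl x ∈ R → c x ≠ i) → Sum.inr i ∈ R := by
    intro i hi
    have : i ∈ R.image (Sum.elim c id) := himg ▸ Finset.mem_univ i
    obtain ⟨x | l, hx, hxi⟩ := Finset.mem_image.1 this
    · exact absurd hxi (hi x hx)
    · obtain rfl : l = i := hxi
      exact hx
  have hmain : ∀ y, ∃ i, (∃ x, Sum.inl x ∈ R ∧ c x = i) ∧
      ∀ x, Sum.inl x ∈ R → f y i ≤ f x i := by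
    intro y
    obtain ⟨i, hi⟩ := hR (Sum.inl y)
    refine ⟨i, ?_, fun x hx => ?_⟩
    · by_contra! h
      exact absurd (hi _ (hslack i h)) (not_le.2 (hlow i (Sum.inl y) (by simp)))
    · have := hi _ hx
      simp only [r, Sum.elim_inl, Prod.Lex.toLex_le_toLex] at this
      rcases this with h | h
      · exact h.le
      · exact h.1.le
  refine ⟨Finset.univ.filter fun x => Sum.inl x ∈ R, ?_, fun y => ?_⟩
  · obtain ⟨i, ⟨x, hx, -⟩, -⟩ := hmain (Classical.arbitrary X)
    exact ⟨x, by simpa using hx⟩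
  · obtain ⟨i, ⟨x, hx, hxi⟩, h⟩ := hmain y
    exact ⟨i, Finset.mem_image.2 ⟨x, by simpa using hx, hxi⟩, fun z hz => h z (by simpa using hz)⟩

/-- Approximate form of the dual KKM lemma: for sets covering the simplex, there are points of
the simplex which for every `i` are close to the `i`-th set or to the `i`-th facet. -/
theorem exists_mem_stdSimplex_near {I : Type*} [Fintype I] [Nonempty I]
    (B : I → Set (I → ℝ)) (hB : ∀ x ∈ stdSimplex ℝ I, ∃ i, x ∈ B i) {ε : ℝ} (hε : 0 < ε) :
    ∃ x ∈ stdSimplex ℝ I, ∀ i, x i ≤ ε ∨ ∃ z ∈ B i, dist x z ≤ ε := by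
  classical
  have hn : (0 : ℝ) < Fintype.card I := by exact_mod_cast Fintype.card_pos
  set δ : ℝ := ε / Fintype.card I with hδdef
  have hδ : 0 < δ := div_pos hε hn
  obtain ⟨t, htΔ, htfin, htcov⟩ := (isCompact_stdSimplex ℝ I).finite_cover_balls hδ
  have : Fintype t := htfin.fintype
  have hnet : ∀ y ∈ stdSimplex ℝ I, ∃ p : t, dist y p < δ := by
    intro y hy
    obtain ⟨p, hp, hyp⟩ := Set.mem_iUnion₂.1 (htcov hy)
    exact ⟨⟨p, hp⟩, hyp⟩
  have : Nonempty t := by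
    obtain ⟨p, -⟩ := hnet _ (single_mem_stdSimplex ℝ (Classical.arbitrary I))
    exact ⟨p⟩
  choose c hc using fun p : t => hB p (htΔ p.2)
  obtain ⟨D, hDne, hD⟩ := exists_dominant_of_coloring (fun (p : t) i => (p : I → ℝ) i)
    (fun p i => mem_Icc_of_mem_stdSimplex (htΔ p.2) i) c
  set C := D.image c with hC
  have hCne : C.Nonempty := hDne.image c
  choose q hqD hq using fun i : I => D.exists_min_image (fun p : t => (p : I → ℝ) i) hDne
  let m : I → ℝ := fun i => if i ∈ C then (q i : I → ℝ) i else 0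
  have hm0 : ∀ i, 0 ≤ m i := by
    intro i
    by_cases hi : i ∈ C
    · simpa [m, hi] using (htΔ (q i).2).1 i
    · simp [m, hi]
  have hmle : ∀ p ∈ D, ∀ i, m i ≤ (p : I → ℝ) i := by
    intro p hp i
    by_cases hi : i ∈ C
    · simpa [m, hi] using hq i p hp
    · simpa [m, hi] using (htΔ p.2).1 i
  have hsum : 1 ≤ ∑ i, (m i + δ) := by
    by_contra! hlt
    obtain ⟨i₁, hi₁⟩ := hCne
    let y : I → ℝ := (fun i => m i + δ) + Pi.single i₁ (1 - ∑ i, (m i + δ))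
    have hyge : ∀ i, m i + δ ≤ y i := by
      intro i
      have : (0 : I → ℝ) ≤ Pi.single i₁ (1 - ∑ i, (m i + δ)) :=
        Pi.single_nonneg.2 (by linarith)
      have := this i
      simp only [y, Pi.add_apply, Pi.zero_apply] at this ⊢
      linarith
    have hy : y ∈ stdSimplex ℝ I := by
      refine ⟨fun i => by linarith [hyge i, hm0 i], ?_⟩
      simp only [y, Pi.add_apply, Finset.sum_add_distrib, Finset.sum_pi_single',
        Finset.mem_univ, if_true]
      ring
    obtain ⟨p, hp⟩ := hnet y hy
    obtain ⟨i, hiC, hi⟩ := hD p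
    have h1 := hi (q i) (hqD i)
    have h2 := (dist_le_pi_dist y p i).trans_lt hp
    rw [Real.dist_eq, abs_lt] at h2
    have h3 := hyge i
    simp only [m, if_pos hiC] at h3
    linarith [h2.2]
  have hupper : ∀ p ∈ D, ∀ i, (p : I → ℝ) i ≤ m i + ε := by
    intro p hp i
    have h1 : (p : I → ℝ) i - m i ≤ ∑ j, ((p : I → ℝ) j - m j) :=
      Finset.single_le_sum (f := fun j => (p : I → ℝ) j - m j)
        (fun j _ => sub_nonneg.2 (hmle p hp j)) (Finset.mem_univ i)
    rw [Finset.sum_sub_distrib, (htΔ p.2).2] at h1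
    rw [Finset.sum_add_distrib, Finset.sum_const, Finset.card_univ, nsmul_eq_mul, hδdef,
      mul_div_cancel₀ _ hn.ne'] at hsum
    linarith
  obtain ⟨p, hp⟩ := hDne
  refine ⟨p, htΔ p.2, fun i => ?_⟩
  by_cases hi : i ∈ C
  · right
    obtain ⟨z, hz, rfl⟩ := Finset.mem_image.1 hi
    refine ⟨z, hc z, (dist_pi_le_iff hε.le).2 fun j => ?_⟩
    rw [Real.dist_eq, abs_le]
    constructor <;> linarith [hmle p hp j, hmle z hz j, hupper p hp j, hupper z hz j]
  · left
    simpa [m, hi] using hupper p hp i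

/-- Dual KKM lemma: closed sets covering the simplex, the `i`-th of which contains the facet
opposite to the `i`-th vertex, have a common point in the simplex. -/
theorem exists_mem_stdSimplex_forall_mem {I : Type*} [Fintype I] [Nonempty I]
    (B : I → Set (I → ℝ)) (hclosed : ∀ i, IsClosed (B i))
    (hB : ∀ x ∈ stdSimplex ℝ I, ∃ i, x ∈ B i)
    (hfacet : ∀ x ∈ stdSimplex ℝ I, ∀ i, x i = 0 → x ∈ B i) :
    ∃ x ∈ stdSimplex ℝ I, ∀ i, x ∈ B i := by
  classical
  let h : I → (I → ℝ) → ℝ := fun i x =>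
    if (B i).Nonempty then min (x i) (Metric.infDist x (B i)) else x i
  have hcont : Continuous fun x => ∑ i, h i x := by
    refine continuous_finsetSum _ fun i _ => ?_
    by_cases hi : (B i).Nonempty
    · simp only [h, if_pos hi]
      exact (continuous_apply i).min (Metric.continuous_infDist_pt _)
    · simp only [h, if_neg hi]
      exact continuous_apply i
  have hnonneg : ∀ x ∈ stdSimplex ℝ I, ∀ i, 0 ≤ h i x := by
    intro x hx i
    by_cases hi : (B i).Nonempty
    · simp only [h, if_pos hi]
      exact le_min (hx.1 i) Metric.infDist_nonneg
    · simp only [h, if_neg hi]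
      exact hx.1 i
  obtain ⟨x, hx, hxmin⟩ := (isCompact_stdSimplex ℝ I).exists_isMinOn
    ⟨_, single_mem_stdSimplex ℝ (Classical.arbitrary I)⟩ hcont.continuousOn
  have hn : (0 : ℝ) < Fintype.card I := by exact_mod_cast Fintype.card_pos
  have hzero : ∑ i, h i x ≤ 0 := by
    refine le_of_forall_pos_le_add fun ε hε => ?_
    obtain ⟨y, hy, hyB⟩ := exists_mem_stdSimplex_near B hB (div_pos hε hn)
    refine (hxmin hy).trans ?_
    have : ∀ i ∈ Finset.univ, h i y ≤ ε / Fintype.card I := by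
      intro i _
      rcases hyB i with hi | ⟨z, hz, hd⟩
      · by_cases hne : (B i).Nonempty
        · simp only [h, if_pos hne]
          exact (min_le_left _ _).trans hi
        · simp only [h, if_neg hne]
          exact hi
      · have hne : (B i).Nonempty := ⟨z, hz⟩
        simp only [h, if_pos hne]
        exact (min_le_right _ _).trans ((Metric.infDist_le_dist_of_mem hz).trans hd)
    refine (Finset.sum_le_sum this).trans ?_
    rw [Finset.sum_const, Finset.card_univ, nsmul_eq_mul, mul_div_cancel₀ _ hn.ne', zero_add]
  refine ⟨x, hx, fun i => ?_⟩
  have hi0 : h i x = 0 := (Finset.sum_eq_zero_iff_of_nonneg fun i _ => hnonneg x hx i).1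
    (le_antisymm hzero (Finset.sum_nonneg fun i _ => hnonneg x hx i)) i (Finset.mem_univ i)
  by_cases hne : (B i).Nonempty
  · simp only [h, if_pos hne] at hi0
    rcases min_choice (x i) (Metric.infDist x (B i)) with h' | h'
    · exact hfacet x hx i (h'.symm.trans hi0)
    · exact ((hclosed i).mem_iff_infDist_zero hne).2 (h'.symm.trans hi0)
  · simp only [h, if_neg hne] at hi0
    exact hfacet x hx i hi0

/-- The KKM lemma for the standard simplex, with faces described by supports. -/
theorem exists_mem_of_forall_stdSimplex_face {I : Type*} [Fintype I] [Nonempty I]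
    (A : I → Set (I → ℝ)) (hclosed : ∀ i, IsClosed (A i)) (hne : ∀ i, (A i).Nonempty)
    (hface : ∀ x ∈ stdSimplex ℝ I, ∃ i, 0 < x i ∧ x ∈ A i) :
    ∃ x, ∀ i, x ∈ A i := by
  let S : (I → ℝ) → ℝ := fun x => ∑ j, Metric.infDist x (A j)
  have hS : Continuous S := continuous_finsetSum _ fun j _ => Metric.continuous_infDist_pt _
  have hS0 : ∀ x, 0 ≤ S x := fun x => Finset.sum_nonneg fun j _ => Metric.infDist_nonneg
  have hsum : ∀ x ∈ stdSimplex ℝ I, ∑ i, x i * S x = ∑ i, Metric.infDist x (A i) := by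
    intro x hx
    rw [← Finset.sum_mul, hx.2, one_mul]
  obtain ⟨x, hx, hxB⟩ := exists_mem_stdSimplex_forall_mem
    (fun i => {x : I → ℝ | x i * S x ≤ Metric.infDist x (A i)})
    (fun i => isClosed_le ((continuous_apply i).mul hS) (Metric.continuous_infDist_pt _))
    (fun x hx => by
      obtain ⟨i, -, hi⟩ := Finset.exists_le_of_sum_le Finset.univ_nonempty (hsum x hx).le
      exact ⟨i, hi⟩)
    (fun x _ i hi => by
      simpa [hi] using Metric.infDist_nonneg)
  have heq := (Finset.sum_eq_sum_iff_of_le fun i _ => hxB i).1 (hsum x hx)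
  obtain ⟨i, hi, hiA⟩ := hface x hx
  have hSx : S x = 0 := by
    have := heq i (Finset.mem_univ i)
    rw [Metric.infDist_zero_of_mem hiA] at this
    exact (mul_eq_zero.1 this).resolve_left hi.ne'
  refine ⟨x, fun j => ((hclosed j).mem_iff_infDist_zero (hne j)).2 ?_⟩
  rw [← heq j (Finset.mem_univ j), hSx, mul_zero]


/-- The Knaster–Kuratowski–Mazurkiewicz lemma: if the standard simplex
`Δ = conv{e_1, …, e_k} ⊆ ℝ^k` is covered by closed sets `A_1, …, A_k ⊆ Δ` such
that every face `conv{e_i : i ∈ S}` lies in `⋃_{i ∈ S} A_i`, then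
`A_1 ∩ … ∩ A_k ≠ ∅`. -/
theorem kkm_lemma (k : ℕ) (hk : 1 ≤ k)
    (A : Fin k → Set (EuclideanSpace ℝ (Fin k)))
    (hclosed : ∀ i, IsClosed (A i))
    (hsub : ∀ i, A i ⊆
      convexHull ℝ (Set.range fun j : Fin k => EuclideanSpace.single j (1 : ℝ)))
    (hface : ∀ S : Finset (Fin k), S.Nonempty →
      convexHull ℝ ((fun j : Fin k => EuclideanSpace.single j (1 : ℝ)) '' (S : Set (Fin k)))
        ⊆ ⋃ i ∈ S, A i) :
    (⋂ i, A i).Nonempty := by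
  have : Nonempty (Fin k) := ⟨⟨0, hk⟩⟩
  have hcont : Continuous (WithLp.toLp 2 : (Fin k → ℝ) → EuclideanSpace ℝ (Fin k)) :=
    PiLp.continuous_toLp 2 _
  obtain ⟨x, hx⟩ := exists_mem_of_forall_stdSimplex_face (fun i => WithLp.toLp 2 ⁻¹' A i)
    (fun i => (hclosed i).preimage hcont)
    (fun i => by
      have := hface {i} (Finset.singleton_nonempty i)
        (subset_convexHull ℝ _ ⟨i, by simp, rfl⟩)
      exact ⟨Pi.single i 1, by simpa using this⟩)
    (fun x hx => by
      classical
      let S : Finset (Fin k) := Finset.univ.filter fun i => 0 < x i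
      have hoff : ∀ i ∈ Finset.univ, i ∉ S → x i = 0 := fun i _ hi =>
        le_antisymm (not_lt.1 fun h => hi (Finset.mem_filter.2 ⟨Finset.mem_univ i, h⟩)) (hx.1 i)
      have hS1 : ∑ i ∈ S, x i = 1 := by
        rw [Finset.sum_subset (Finset.subset_univ S) hoff, hx.2]
      have hSne : S.Nonempty := by
        by_contra h
        rw [Finset.not_nonempty_iff_eq_empty.1 h] at hS1
        simp at hS1
      have hrep : WithLp.toLp 2 x = ∑ i ∈ S, x i • EuclideanSpace.single i (1 : ℝ) := by
        rw [Finset.sum_subset (Finset.subset_univ S) fun i hi hiS => by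
          rw [hoff i hi hiS, zero_smul]]
        ext j
        simp [Pi.single_apply]
      have hmem := (convex_convexHull ℝ ((fun j : Fin k => EuclideanSpace.single j (1 : ℝ)) ''
        (S : Set (Fin k)))).sum_mem (t := S) (w := x) (fun i _ => hx.1 i) hS1
        (fun i hi => subset_convexHull ℝ _ ⟨i, hi, rfl⟩)
      rw [← hrep] at hmem
      obtain ⟨i, hi, hiA⟩ := Set.mem_iUnion₂.1 (hface S hSne hmem)
      exact ⟨i, (Finset.mem_filter.1 hi).2, hiA⟩)
  exact ⟨WithLp.toLp 2 x, Set.mem_iInter.2 hx⟩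
end

section
/- The set of stationary ergodic Borel probability measures on Ω is dense in the set of stationary Borel probability measures on Ω, with respect to the topology of weak convergence. -/
open MeasureTheory

/-- The left shift on Cantor space. -/
def shiftMap : (ℕ → Bool) → (ℕ → Bool) := fun ω i => ω (i + 1)

/-- A measure on Cantor space is stationary if it is shift-invariant. -/
def StationaryMeasure (P : Measure (ℕ → Bool)) : Prop :=
  ∀ A : Set (ℕ → Bool), MeasurableSet A → P (shiftMap ⁻¹' A) = P A

/-- A stationary measure is ergodic if every strictly shift-invariant Borel set
has measure `0` or `1`. -/
def ErgodicStationaryMeasure (P : Measure (ℕ → Bool)) : Prop :=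
  StationaryMeasure P ∧
  ∀ A : Set (ℕ → Bool), MeasurableSet A → shiftMap ⁻¹' A = A → P A = 0 ∨ P A = 1

open Filter ProbabilityTheory
open scoped Topology ENNReal

/-- A shift-invariant event of an i.i.d. sequence has probability `0` or `1`. -/
theorem infinitePi_eq_zero_or_one_of_shift_invariant {X : Type*} [MeasurableSpace X]
    (P : Measure X) [IsProbabilityMeasure P] {B : Set (ℕ → X)} (hB : MeasurableSet B)
    (hinv : (fun (x : ℕ → X) i => x (i + 1)) ⁻¹' B = B) :
    Measure.infinitePi (fun _ : ℕ => P) B = 0 ∨ Measure.infinitePi (fun _ : ℕ => P) B = 1 := by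
  have hiter : ∀ n : ℕ, (fun (x : ℕ → X) i => x (i + n)) ⁻¹' B = B := by
    intro n
    induction n with
    | zero => rfl
    | succ n ih =>
      conv_rhs => rw [← ih, ← hinv]
      ext x
      simp only [Set.mem_preimage, add_assoc, add_comm 1 n]
  have hindep : iIndep (fun i : ℕ => MeasurableSpace.comap (fun x : ℕ → X => x i) inferInstance)
      (Measure.infinitePi (fun _ : ℕ => P)) :=
    iIndepFun_infinitePi (X := fun _ => id) (fun _ => measurable_id)
  refine measure_zero_or_one_of_measurableSet_limsup_atTop
    (fun n => (measurable_pi_apply n).comap_le) hindep ?_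
  rw [limsup_eq_iInf_iSup_of_nat, MeasurableSpace.measurableSet_iInf]
  intro n
  rw [← hiter n]
  refine @measurableSet_preimage _ _ (_) _ _ _ ?_ hB
  refine @measurable_pi_lambda _ _ _ (_) _ _ fun i => ?_
  refine Measurable.of_comap_le (le_iSup₂_of_le (i + n) (Nat.le_add_left n i) le_rfl)

theorem measurePreserving_shift_infinitePi {X : Type*} [MeasurableSpace X]
    (P : Measure X) [IsProbabilityMeasure P] :
    MeasurePreserving (fun (x : ℕ → X) i => x (i + 1))
      (Measure.infinitePi (fun _ : ℕ => P)) (Measure.infinitePi (fun _ : ℕ => P)) :=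
  ⟨by fun_prop, Measure.map_infinitePi_infinitePi_of_inj (P := fun _ : ℕ => P)
    (add_left_injective 1)⟩

/-- The average of the first `N` iterates of a measure which is invariant under `f^[N]` is
invariant under `f`. -/
theorem MeasureTheory.MeasurePreserving.sum_range_map_iterate {X : Type*} [MeasurableSpace X]
    {ν : Measure X} {f : X → X} (hf : Measurable f) {N : ℕ} (h : MeasurePreserving f^[N] ν ν) :
    MeasurePreserving f (∑ j ∈ Finset.range N, ν.map f^[j])
      (∑ j ∈ Finset.range N, ν.map f^[j]) := by
  refine ⟨hf, ?_⟩
  ext A hA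
  rw [Measure.map_apply hf hA]
  simp only [Measure.coe_finsetSum, Finset.sum_apply]
  have hstep : ∀ j, ν.map f^[j] (f ⁻¹' A) = ν.map f^[j + 1] A := by
    intro j
    rw [Measure.map_apply (hf.iterate j) (hf hA), Measure.map_apply (hf.iterate (j + 1)) hA,
      Function.iterate_succ', Set.preimage_comp]
  simp only [hstep]
  have hends : ν.map f^[N] A = ν.map f^[0] A := by
    rw [h.map_eq, Function.iterate_zero, Measure.map_id]
  cases N with
  | zero => simp
  | succ M => rw [Finset.sum_range_succ, hends, Finset.sum_range_succ']

theorem measurable_shiftMap : Measurable shiftMap := by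
  unfold shiftMap
  fun_prop

theorem shiftMap_iterate_apply (j : ℕ) (ω : ℕ → Bool) (i : ℕ) :
    shiftMap^[j] ω i = ω (i + j) := by
  induction j generalizing ω with
  | zero => rfl
  | succ j ih => rw [Function.iterate_succ_apply, ih, shiftMap, add_assoc]

theorem stationaryMeasure_iff_measurePreserving {P : Measure (ℕ → Bool)} :
    StationaryMeasure P ↔ MeasurePreserving shiftMap P P := by
  refine ⟨fun h => ⟨measurable_shiftMap, ?_⟩, fun h A hA => h.measure_preimage hA.nullMeasurableSet⟩
  ext A hA
  rw [Measure.map_apply measurable_shiftMap hA, h A hA]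

/-- Concatenation of the initial blocks of length `N` of a sequence of elements of Cantor space. -/
def concatBlocks (N : ℕ) (x : ℕ → ℕ → Bool) : ℕ → Bool := fun i => x (i / N) (i % N)

theorem measurable_concatBlocks (N : ℕ) : Measurable (concatBlocks N) := by
  unfold concatBlocks
  fun_prop

theorem shiftMap_iterate_concatBlocks {N : ℕ} (hN : 0 < N) (x : ℕ → ℕ → Bool) :
    shiftMap^[N] (concatBlocks N x) = concatBlocks N (fun i => x (i + 1)) := by
  ext i
  simp [shiftMap_iterate_apply, concatBlocks, Nat.add_div_right i hN]

/-- The law of a concatenation of independent blocks of length `N` distributed as under `P`. -/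
noncomputable def concatMeasure (P : Measure (ℕ → Bool)) (N : ℕ) : Measure (ℕ → Bool) :=
  (Measure.infinitePi (fun _ : ℕ => P)).map (concatBlocks N)

/-- The concatenation of independent blocks of length `N`, with a uniform random phase. -/
noncomputable def blockMeasure (P : Measure (ℕ → Bool)) (N : ℕ) : Measure (ℕ → Bool) :=
  (N : ℝ≥0∞)⁻¹ • ∑ j ∈ Finset.range N, (concatMeasure P N).map shiftMap^[j]

section

variable {P : Measure (ℕ → Bool)} [IsProbabilityMeasure P]

instance isProbabilityMeasure_concatMeasure (N : ℕ) :
    IsProbabilityMeasure (concatMeasure P N) :=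
  Measure.isProbabilityMeasure_map (measurable_concatBlocks N).aemeasurable

instance isProbabilityMeasure_map_iterate_concatMeasure (N j : ℕ) :
    IsProbabilityMeasure ((concatMeasure P N).map shiftMap^[j]) :=
  Measure.isProbabilityMeasure_map (measurable_shiftMap.iterate j).aemeasurable

theorem isProbabilityMeasure_blockMeasure {N : ℕ} (hN : 0 < N) :
    IsProbabilityMeasure (blockMeasure P N) := by
  refine ⟨?_⟩
  simp [blockMeasure, ENNReal.inv_mul_cancel (Nat.cast_ne_zero.2 hN.ne') (ENNReal.natCast_ne_top N)]

theorem measurePreserving_iterate_concatMeasure {N : ℕ} (hN : 0 < N) :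
    MeasurePreserving shiftMap^[N] (concatMeasure P N) (concatMeasure P N) := by
  refine ⟨measurable_shiftMap.iterate N, ?_⟩
  have hcomp : shiftMap^[N] ∘ concatBlocks N
      = concatBlocks N ∘ fun (x : ℕ → ℕ → Bool) i => x (i + 1) :=
    funext (shiftMap_iterate_concatBlocks hN)
  rw [concatMeasure, Measure.map_map (measurable_shiftMap.iterate N) (measurable_concatBlocks N),
    hcomp, ← Measure.map_map (measurable_concatBlocks N)
      (measurePreserving_shift_infinitePi P).measurable,
    (measurePreserving_shift_infinitePi P).map_eq]

theorem ergodicStationaryMeasure_blockMeasure {N : ℕ} (hN : 0 < N) :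
    ErgodicStationaryMeasure (blockMeasure P N) := by
  refine ⟨stationaryMeasure_iff_measurePreserving.2
    (((measurePreserving_iterate_concatMeasure hN).sum_range_map_iterate
      measurable_shiftMap).smul_measure _), fun A hA hinv => ?_⟩
  have hiter : ∀ j : ℕ, shiftMap^[j] ⁻¹' A = A := by
    intro j
    rw [Set.preimage_iterate_eq, Function.iterate_fixed hinv]
  have hA_eq : blockMeasure P N A = concatMeasure P N A := by
    simp only [blockMeasure, Measure.smul_apply, Measure.coe_finsetSum, Finset.sum_apply,
      Measure.map_apply (measurable_shiftMap.iterate _) hA, hiter, Finset.sum_const,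
      Finset.card_range, nsmul_eq_mul, smul_eq_mul]
    rw [← mul_assoc, ENNReal.inv_mul_cancel (Nat.cast_ne_zero.2 hN.ne')
      (ENNReal.natCast_ne_top N), one_mul]
  rw [hA_eq, concatMeasure, Measure.map_apply (measurable_concatBlocks N) hA]
  refine infinitePi_eq_zero_or_one_of_shift_invariant P (measurable_concatBlocks N hA) ?_
  ext x
  rw [Set.mem_preimage, Set.mem_preimage, ← shiftMap_iterate_concatBlocks hN, ← Set.mem_preimage,
    hiter, Set.mem_preimage]

/-- Away from the block boundaries, the concatenation measure agrees with `P` on the events which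
depend only on the first `k` coordinates. -/
theorem map_iterate_concatMeasure_apply (hP : MeasurePreserving shiftMap P P) {N j k : ℕ}
    (hjk : j + k ≤ N) {A : Set (ℕ → Bool)} (hA : MeasurableSet A)
    (hdep : DependsOn (· ∈ A) (Set.Iio k)) :
    (concatMeasure P N).map shiftMap^[j] A = P A := by
  have hpre : concatBlocks N ⁻¹' (shiftMap^[j] ⁻¹' A)
      = (fun x : ℕ → ℕ → Bool => x 0) ⁻¹' (shiftMap^[j] ⁻¹' A) := by
    ext x
    refine iff_of_eq (hdep fun i hi => ?_)
    have hlt : i + j < N := by rw [Set.mem_Iio] at hi; omega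
    simp [shiftMap_iterate_apply, concatBlocks, Nat.div_eq_of_lt hlt, Nat.mod_eq_of_lt hlt]
  have hAj := measurable_shiftMap.iterate j hA
  rw [Measure.map_apply (measurable_shiftMap.iterate j) hA, concatMeasure,
    Measure.map_apply (measurable_concatBlocks N) hAj, hpre,
    (measurePreserving_eval_infinitePi (fun _ : ℕ => P) 0).measure_preimage
      hAj.nullMeasurableSet,
    (hP.iterate j).measure_preimage hA.nullMeasurableSet]

theorem abs_blockMeasure_real_sub_le (hP : MeasurePreserving shiftMap P P) {N k : ℕ}
    (hN : 0 < N) {A : Set (ℕ → Bool)} (hA : MeasurableSet A)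
    (hdep : DependsOn (· ∈ A) (Set.Iio k)) :
    |(blockMeasure P N).real A - P.real A| ≤ k / N := by
  have hN' : (0 : ℝ) < N := Nat.cast_pos.2 hN
  have hreal : (blockMeasure P N).real A
      = (N : ℝ)⁻¹ * ∑ j ∈ Finset.range N, ((concatMeasure P N).map shiftMap^[j]).real A := by
    simp [blockMeasure, measureReal_def, ENNReal.toReal_sum]
  have hterm : ∀ j ∈ Finset.range N,
      |((concatMeasure P N).map shiftMap^[j]).real A - P.real A|
        ≤ if N < j + k then (1 : ℝ) else 0 := by
    intro j _
    split_ifs with hjk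
    · exact abs_sub_le_of_nonneg_of_le measureReal_nonneg measureReal_le_one
        measureReal_nonneg measureReal_le_one
    · rw [measureReal_def, measureReal_def,
        map_iterate_concatMeasure_apply hP (not_lt.1 hjk) hA hdep, sub_self, abs_zero]
  have hcard : ((Finset.range N).filter fun j => N < j + k).card ≤ k := by
    calc _ ≤ (Finset.Ico (N - k) N).card := by
          refine Finset.card_le_card fun j hj => ?_
          rw [Finset.mem_filter, Finset.mem_range] at hj
          rw [Finset.mem_Ico]
          omega
      _ ≤ k := by rw [Nat.card_Ico]; omega
  have hsum : |∑ j ∈ Finset.range N,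
      (((concatMeasure P N).map shiftMap^[j]).real A - P.real A)| ≤ k := by
    refine (Finset.abs_sum_le_sum_abs _ _).trans ((Finset.sum_le_sum hterm).trans ?_)
    rw [Finset.sum_boole]
    exact_mod_cast hcard
  have hsub : (blockMeasure P N).real A - P.real A = (∑ j ∈ Finset.range N,
      (((concatMeasure P N).map shiftMap^[j]).real A - P.real A)) / N := by
    rw [hreal, Finset.sum_sub_distrib, Finset.sum_const, Finset.card_range, nsmul_eq_mul]
    field_simp
  rw [hsub, abs_div, abs_of_pos hN']
  gcongr

end

/-- Pointwise convergence on events depending on finitely many coordinates implies weak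
convergence on Cantor space. -/
theorem tendsto_probabilityMeasure_of_tendsto_cylinder {Q : ℕ → ProbabilityMeasure (ℕ → Bool)}
    {P : ProbabilityMeasure (ℕ → Bool)}
    (h : ∀ (A : Set (ℕ → Bool)) (k : ℕ), MeasurableSet A → DependsOn (· ∈ A) (Set.Iio k) →
      Tendsto (fun n => (Q n : Measure (ℕ → Bool)).real A) atTop
        (𝓝 ((P : Measure (ℕ → Bool)).real A))) :
    Tendsto Q atTop (𝓝 P) := by
  refine IsPiSystem.tendsto_probabilityMeasure_of_tendsto_of_mem
    (S := {A | MeasurableSet A ∧ ∃ k, DependsOn (· ∈ A) (Set.Iio k)}) ?_ (fun A hA => hA.1) ?_ ?_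
  · rintro A ⟨hA, k, hk⟩ B ⟨hB, l, hl⟩ _
    refine ⟨hA.inter hB, max k l, fun x y hxy => ?_⟩
    exact congrArg₂ And (hk fun i hi => hxy i (lt_of_lt_of_le hi (le_max_left k l)))
      (hl fun i hi => hxy i (lt_of_lt_of_le hi (le_max_right k l)))
  · intro u hu x hx
    obtain ⟨_, ⟨z, n, rfl⟩, hxz, hzu⟩ :=
      (PiNat.isTopologicalBasis_cylinders fun _ : ℕ => Bool).exists_subset_of_mem_open hx hu
    have hopen := PiNat.isOpen_cylinder (fun _ : ℕ => Bool) z n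
    refine ⟨_, ⟨hopen.measurableSet, n, fun x y hxy => ?_⟩, hopen.mem_nhds hxz, hzu⟩
    refine propext (forall₂_congr fun i hi => ?_)
    rw [hxy i hi]
  · rintro A ⟨hA, k, hk⟩
    have := h A k hA hk
    rw [← NNReal.tendsto_coe]
    simpa using this

/-- The stationary ergodic probability measures on Cantor space are dense in
the stationary probability measures (weak topology). -/
theorem ergodic_dense_in_stationary
    (P : ProbabilityMeasure (ℕ → Bool)) (hP : StationaryMeasure (P : Measure (ℕ → Bool))) :
    P ∈ closure {Q : ProbabilityMeasure (ℕ → Bool) |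
      ErgodicStationaryMeasure (Q : Measure (ℕ → Bool))} := by
  have hP' := stationaryMeasure_iff_measurePreserving.1 hP
  let Q : ℕ → ProbabilityMeasure (ℕ → Bool) := fun n =>
    ⟨blockMeasure P (n + 1), isProbabilityMeasure_blockMeasure n.succ_pos⟩
  have hQ : Tendsto Q atTop (𝓝 P) := by
    refine tendsto_probabilityMeasure_of_tendsto_cylinder fun A k hA hk => ?_
    refine tendsto_iff_norm_sub_tendsto_zero.2 (squeeze_zero (fun _ => norm_nonneg _)
      (fun n => abs_blockMeasure_real_sub_le hP' n.succ_pos hA hk) ?_)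
    exact (tendsto_const_div_atTop_nhds_zero_nat (k : ℝ)).comp (tendsto_add_atTop_nat 1)
  exact mem_closure_of_tendsto hQ
    (Eventually.of_forall fun n => ergodicStationaryMeasure_blockMeasure n.succ_pos)
end

section
/- Let X be a metric space, let C be a compact set of Borel probability measures on X (in the topology of weak convergence), and let S ⊆ X be an open set with P(S) = 1 for every P ∈ C. Then for every ε > 0 there exists a continuous function h : X → [0,1] with h(x) = 0 for every x ∉ S and ∫ h dP > 1 − ε for every P ∈ C. -/
open MeasureTheory

/-- Compactness form of the approximation: an increasing sequence of bounded continuous functions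
with values in `[0, 1]` that converges to `1` almost everywhere for every measure in a weakly
compact class has integrals that are eventually close to `1` uniformly over the class. -/
theorem exists_forall_lt_integral_of_isCompact {X : Type*} [TopologicalSpace X]
    [MeasurableSpace X] [OpensMeasurableSpace X]
    {C : Set (ProbabilityMeasure X)} (hC : IsCompact C)
    {f : ℕ → BoundedContinuousFunction X ℝ} (hmono : Monotone f)
    (hf : ∀ n x, f n x ∈ Set.Icc (0 : ℝ) 1)
    (hlim : ∀ P ∈ C, ∀ᵐ x ∂(P : Measure X),
      Filter.Tendsto (fun n ↦ f n x) Filter.atTop (nhds 1))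
    {ε : ℝ} (hε : 0 < ε) :
    ∃ n, ∀ P ∈ C, 1 - ε < ∫ x, f n x ∂(P : Measure X) := by
  refine hC.elim_directed_cover
    (fun n ↦ {P : ProbabilityMeasure X | 1 - ε < ∫ x, f n x ∂(P : Measure X)})
    (fun n ↦ isOpen_lt continuous_const
      (ProbabilityMeasure.continuous_integral_boundedContinuousFunction (f n))) ?_ ?_
  · intro P hP
    have key : Filter.Tendsto (fun n ↦ ∫ x, f n x ∂(P : Measure X)) Filter.atTop
        (nhds (∫ _, (1 : ℝ) ∂(P : Measure X))) := by
      refine tendsto_integral_of_dominated_convergence (fun _ ↦ (1 : ℝ))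
        (fun n ↦ ((f n).integrable _).aestronglyMeasurable) (integrable_const _)
        (fun n ↦ .of_forall fun x ↦ ?_) (hlim P hP)
      rw [Real.norm_of_nonneg (hf n x).1]
      exact (hf n x).2
    have hlt : 1 - ε < ∫ _, (1 : ℝ) ∂(P : Measure X) := by simpa using hε
    obtain ⟨n, hn⟩ := (key.eventually (lt_mem_nhds hlt)).exists
    exact Set.mem_iUnion.2 ⟨n, hn⟩
  · refine Monotone.directed_le fun m n hmn P (hP : 1 - ε < _) ↦ hP.trans_le ?_
    exact integral_mono ((f m).integrable _) ((f n).integrable _) (hmono hmn)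

/-- The indicator of an open set is the pointwise limit of an increasing sequence of bounded
continuous functions with values in `[0, 1]`. -/
theorem exists_monotone_seq_tendsto_one_of_isOpen {X : Type*} [PseudoEMetricSpace X]
    {S : Set X} (hS : IsOpen S) :
    ∃ f : ℕ → BoundedContinuousFunction X ℝ, Monotone f ∧
      (∀ n x, f n x ∈ Set.Icc (0 : ℝ) 1) ∧ (∀ n, ∀ x ∉ S, f n x = 0) ∧
      ∀ x ∈ S, Filter.Tendsto (fun n ↦ f n x) Filter.atTop (nhds 1) := by
  have hδ (n : ℕ) : (0 : ℝ) < 1 / ((n : ℝ) + 1) := Nat.one_div_pos_of_nat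
  have hle (n : ℕ) (x : X) : (thickenedIndicator (hδ n) Sᶜ x : ℝ) ≤ 1 :=
    mod_cast thickenedIndicator_le_one (hδ n) Sᶜ x
  have hmem (n : ℕ) (x : X) :
      1 - (thickenedIndicator (hδ n) Sᶜ x : ℝ) ∈ Set.Icc (0 : ℝ) 1 :=
    ⟨sub_nonneg.2 (hle n x), sub_le_self _ (NNReal.coe_nonneg _)⟩
  refine ⟨fun n ↦ .ofNormedAddCommGroup (fun x ↦ 1 - (thickenedIndicator (hδ n) Sᶜ x : ℝ))
    (by fun_prop) 1 fun x ↦ ?_, ?_, hmem, ?_, ?_⟩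
  · rw [Real.norm_of_nonneg (hmem n x).1]
    exact (hmem n x).2
  · intro m n hmn x
    exact sub_le_sub_left (NNReal.coe_le_coe.2 (thickenedIndicator_mono (hδ n) (hδ m)
      (Nat.one_div_le_one_div hmn) Sᶜ x)) 1
  · intro n x hx
    change 1 - (thickenedIndicator (hδ n) Sᶜ x : ℝ) = 0
    rw [thickenedIndicator_one (hδ n) Sᶜ hx]
    simp
  · intro x hx
    have h := tendsto_pi_nhds.1 (thickenedIndicator_tendsto_indicator_closure hδ
      tendsto_one_div_add_atTop_nhds_zero_nat Sᶜ) x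
    rw [hS.isClosed_compl.closure_eq, Set.indicator_of_notMem (by simpa using hx)] at h
    simpa using (NNReal.tendsto_coe.2 h).const_sub 1

/-- If `C` is a compact set of Borel probability measures on a metric space `X`
(weak topology) and `S` is an open set with `P(S) = 1` for every `P ∈ C`, then
for every `ε > 0` there is a continuous `h : X → [0,1]` vanishing outside `S`
with `∫ h dP > 1 − ε` for every `P ∈ C`. -/
theorem compact_class_inner_approximation {X : Type*} [MetricSpace X]
    [MeasurableSpace X] [BorelSpace X]
    (C : Set (ProbabilityMeasure X)) (hC : IsCompact C)
    (S : Set X) (hS : IsOpen S)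
    (hPS : ∀ P ∈ C, (P : Measure X) S = 1) :
    ∀ ε : ℝ, 0 < ε →
      ∃ h : X → ℝ, Continuous h ∧ (∀ x, h x ∈ Set.Icc (0 : ℝ) 1) ∧
        (∀ x ∉ S, h x = 0) ∧
        ∀ P ∈ C, (1 : ℝ) - ε < ∫ x, h x ∂(P : Measure X) := by
  intro ε hε
  obtain ⟨f, hmono, hmem, hzero, hlim⟩ := exists_monotone_seq_tendsto_one_of_isOpen hS
  obtain ⟨n, hn⟩ := exists_forall_lt_integral_of_isCompact hC hmono hmem
    (fun P hP ↦ Filter.mem_of_superset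
      ((mem_ae_iff_prob_eq_one hS.measurableSet).2 (hPS P hP)) hlim) hε
  exact ⟨f n, (f n).continuous, hmem n, hzero n, hn⟩
end
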